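/- Every n×n matrix X over a field F is U-equivalent to a unique sub-permutation matrix; that is, there exists exactly one sub-permutation matrix Y such that Y = h'Xk for some upper triangular matrices h, k with all diagonal entries equal to 1. -/

import Mathlib

open Matrix

variable {F : Type*} [Field F] {n : ℕ}

/-- Membership in `U`: upper triangular matrices with all diagonal entries 1. -/
def InU (h : Matrix (Fin n) (Fin n) F) : Prop :=
  (∀ i, h i i = 1) ∧ ∀ i j : Fin n, j < i → h i j = 0

/-- A sub-permutation matrix: at most one nonzero entry in every row and column. -/
def SubPerm (Y : Matrix (Fin n) (Fin n) F) : Prop :=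
  (∀ i j k : Fin n, Y i j ≠ 0 → Y i k ≠ 0 → j = k) ∧
  (∀ i j k : Fin n, Y i k ≠ 0 → Y j k ≠ 0 → i = j)

theorem InU.blockTriangular {h : Matrix (Fin n) (Fin n) F} (hh : InU h) :
    h.BlockTriangular id := fun i j hij => hh.2 i j hij

theorem InU.one : InU (1 : Matrix (Fin n) (Fin n) F) :=
  ⟨fun i => one_apply_eq i, fun _ _ hij => one_apply_ne hij.ne'⟩

theorem mul_apply_diag_of_blockTriangular {A B : Matrix (Fin n) (Fin n) F}
    (hA : A.BlockTriangular id) (hB : B.BlockTriangular id) (i : Fin n) :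
    (A * B) i i = A i i * B i i := by
  rw [mul_apply]
  refine Finset.sum_eq_single i (fun a _ hai => ?_) (by simp)
  rcases lt_or_gt_of_ne hai with h | h
  · rw [hA (show id a < id i from h), zero_mul]
  · rw [hB (show id i < id a from h), mul_zero]

theorem InU.mul {h k : Matrix (Fin n) (Fin n) F} (hh : InU h) (hk : InU k) : InU (h * k) :=
  ⟨fun i => by
    rw [mul_apply_diag_of_blockTriangular hh.blockTriangular hk.blockTriangular, hh.1, hk.1,
      one_mul],
    fun _ _ hij => hh.blockTriangular.mul hk.blockTriangular hij⟩

theorem InU.isUnit_det {h : Matrix (Fin n) (Fin n) F} (hh : InU h) : IsUnit h.det := by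
  rw [det_of_isUpperTriangular hh.blockTriangular]
  simp [hh.1]

theorem InU.inv {h : Matrix (Fin n) (Fin n) F} (hh : InU h) : InU h⁻¹ := by
  have : Invertible h := invertibleOfIsUnitDet h hh.isUnit_det
  have hinv : h⁻¹.BlockTriangular id :=
    blockTriangular_inv_of_blockTriangular hh.blockTriangular
  refine ⟨fun i => ?_, fun _ _ hij => hinv hij⟩
  have := mul_apply_diag_of_blockTriangular hh.blockTriangular hinv i
  rw [mul_nonsing_inv h hh.isUnit_det, one_apply_eq, hh.1, one_mul] at this
  exact this.symm

/-- `U`-equivalence of matrices. -/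
def UEquiv (X Y : Matrix (Fin n) (Fin n) F) : Prop :=
  ∃ h k : Matrix (Fin n) (Fin n) F, InU h ∧ InU k ∧ Y = hᵀ * X * k

theorem UEquiv.refl (X : Matrix (Fin n) (Fin n) F) : UEquiv X X :=
  ⟨1, 1, InU.one, InU.one, by simp⟩

theorem UEquiv.trans {X Y Z : Matrix (Fin n) (Fin n) F} (hXY : UEquiv X Y) (hYZ : UEquiv Y Z) :
    UEquiv X Z := by
  obtain ⟨h, k, hh, hk, rfl⟩ := hXY
  obtain ⟨h', k', hh', hk', rfl⟩ := hYZ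
  exact ⟨h * h', k * k', hh.mul hh', hk.mul hk', by simp only [transpose_mul, Matrix.mul_assoc]⟩

theorem UEquiv.symm {X Y : Matrix (Fin n) (Fin n) F} (hXY : UEquiv X Y) : UEquiv Y X := by
  obtain ⟨h, k, hh, hk, rfl⟩ := hXY
  refine ⟨h⁻¹, k⁻¹, hh.inv, hk.inv, ?_⟩
  have hl : (h⁻¹)ᵀ * hᵀ = 1 := by
    rw [← transpose_mul, mul_nonsing_inv h hh.isUnit_det, transpose_one]
  rw [← Matrix.mul_assoc, ← Matrix.mul_assoc, hl, Matrix.one_mul, Matrix.mul_assoc,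
    mul_nonsing_inv k hk.isUnit_det, Matrix.mul_one]

theorem UEquiv.transpose {X Y : Matrix (Fin n) (Fin n) F} (hXY : UEquiv X Y) :
    UEquiv Xᵀ Yᵀ := by
  obtain ⟨h, k, hh, hk, rfl⟩ := hXY
  exact ⟨k, h, hk, hh, by simp only [transpose_mul, transpose_transpose, Matrix.mul_assoc]⟩

/-- Adding multiples of column `j` to later columns is a `U`-equivalence. -/
theorem uEquiv_add_col (X : Matrix (Fin n) (Fin n) F) (j : Fin n) (f : Fin n → F)
    (hf : ∀ b ≤ j, f b = 0) : UEquiv X (of fun i b => X i b + X i j * f b) := by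
  refine ⟨1, 1 + vecMulVec (Pi.single j 1) f, InU.one, ⟨fun i => ?_, fun a b hab => ?_⟩, ?_⟩
  · rcases eq_or_ne i j with rfl | hij
    · simp [vecMulVec_apply, hf]
    · simp [vecMulVec_apply, hij]
  · rcases eq_or_ne a j with rfl | haj
    · simp [vecMulVec_apply, hf b hab.le, hab.ne']
    · simp [vecMulVec_apply, haj, hab.ne']
  · ext i b
    simp [Matrix.mul_add, mul_vecMulVec, vecMulVec_apply]

/-- Adding multiples of row `m` to later rows is a `U`-equivalence. -/
theorem uEquiv_add_row (X : Matrix (Fin n) (Fin n) F) (m : Fin n) (g : Fin n → F)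
    (hg : ∀ i ≤ m, g i = 0) : UEquiv X (of fun i b => X i b + g i * X m b) := by
  have := (uEquiv_add_col Xᵀ m g hg).transpose
  rw [transpose_transpose] at this
  convert this using 1
  ext i b
  simp [mul_comm]

/-- Every nonzero entry in the first `m` rows is the only one in its row and its column. -/
def CleanRows (m : ℕ) (X : Matrix (Fin n) (Fin n) F) : Prop :=
  ∀ i j : Fin n, (i : ℕ) < m → X i j ≠ 0 →
    (∀ b, b ≠ j → X i b = 0) ∧ ∀ a, a ≠ i → X a j = 0

theorem CleanRows.subPerm {X : Matrix (Fin n) (Fin n) F} (hX : CleanRows n X) : SubPerm X := by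
  refine ⟨fun i j k hj hk => ?_, fun i j k hi hj => ?_⟩
  · by_contra hjk
    exact hj ((hX i k i.2 hk).1 j hjk)
  · by_contra hij
    exact hi ((hX j k j.2 hj).2 i hij)

theorem CleanRows.succ {m : Fin n} {X : Matrix (Fin n) (Fin n) F} (hX : CleanRows m X) :
    ∃ Y, UEquiv X Y ∧ CleanRows (m + 1) Y := by
  by_cases hrow : ∀ j, X m j = 0
  · refine ⟨X, UEquiv.refl X, fun i j hi hij => ?_⟩
    refine hX i j (lt_of_le_of_ne (Nat.le_of_lt_succ hi) fun him => hij ?_) hij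
    rw [Fin.ext him, hrow]
  · push Not at hrow
    obtain ⟨j, hj, hmin⟩ : ∃ j, X m j ≠ 0 ∧ ∀ b < j, X m b = 0 := by
      obtain ⟨j, hj, hmin⟩ := WellFounded.has_min (wellFounded_lt (α := Fin n))
        {j | X m j ≠ 0} hrow
      exact ⟨j, hj, fun b hb => by_contra fun h => hmin b h hb⟩
    have hcol : ∀ a < m, X a j = 0 := fun a ha => by
      by_contra h
      exact hj ((hX a j ha h).2 m ha.ne')
    set f : Fin n → F := fun b => if j < b then -(X m b / X m j) else 0 with hf
    set g : Fin n → F := fun i => if m < i then -(X i j / X m j) else 0 with hg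
    have hf0 : ∀ b ≤ j, f b = 0 := fun b hb => if_neg hb.not_gt
    have hg0 : ∀ i ≤ m, g i = 0 := fun i hi => if_neg hi.not_gt
    have hequiv := (uEquiv_add_col X j f hf0).trans (uEquiv_add_row _ m g hg0)
    set Y : Matrix (Fin n) (Fin n) F := of fun i b =>
      (of fun i b => X i b + X i j * f b) i b + g i * (of fun i b => X i b + X i j * f b) m b
    have hY : ∀ i b, Y i b = X i b + X i j * f b + g i * (X m b + X m j * f b) :=
      fun _ _ => rfl
    have hpivot : ∀ b, b ≠ j → X m b + X m j * f b = 0 := fun b hb => by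
      rcases lt_or_gt_of_ne hb with h | h
      · rw [hmin b h, hf0 b h.le, mul_zero, add_zero]
      · simp only [hf, if_pos h]
        field_simp
        ring
    have hYlt : ∀ a < m, ∀ b, Y a b = X a b := fun a ha b => by
      simp [hY, hcol a ha, hg0 a ha.le]
    have hYm : ∀ b, b ≠ j → Y m b = 0 := fun b hb => by
      simp [hY, hpivot b hb]
    have hYj : ∀ a, a ≠ m → Y a j = 0 := fun a ha => by
      rcases lt_or_gt_of_ne ha with h | h
      · rw [hYlt a h, hcol a h]
      · simp only [hY, hf0 j le_rfl, hg, if_pos h]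
        field_simp
        ring
    refine ⟨Y, hequiv, fun i b hi hib => ?_⟩
    rcases lt_or_eq_of_le (Nat.le_of_lt_succ hi) with him | him
    · rw [hYlt i him] at hib
      obtain ⟨hrowi, hcolb⟩ := hX i b him hib
      refine ⟨fun c hc => (hYlt i him c).trans (hrowi c hc), fun a ha => ?_⟩
      have hbj : b ≠ j := by
        rintro rfl
        exact hib (hcol i him)
      have hfb : f b = 0 := by
        simp [hf, hcolb m (Fin.ne_of_gt him)]
      rw [hY, hpivot b hbj, hfb, hcolb a ha]
      simp
    · obtain rfl := Fin.ext him
      obtain rfl : b = j := by_contra fun h => hib (hYm b h)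
      exact ⟨hYm, hYj⟩

theorem exists_uEquiv_subPerm (X : Matrix (Fin n) (Fin n) F) : ∃ Y, UEquiv X Y ∧ SubPerm Y := by
  have h : ∀ m ≤ n, ∃ Y, UEquiv X Y ∧ CleanRows m Y := by
    intro m
    induction m with
    | zero => exact fun _ => ⟨X, UEquiv.refl X, fun _ _ hi => absurd hi (Nat.not_lt_zero _)⟩
    | succ m ih =>
      intro hm
      obtain ⟨Y, hXY, hY⟩ := ih (Nat.le_of_succ_le hm)
      obtain ⟨Z, hYZ, hZ⟩ := CleanRows.succ (m := ⟨m, hm⟩) hY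
      exact ⟨Z, hXY.trans hYZ, hZ⟩
  obtain ⟨Y, hXY, hY⟩ := h n le_rfl
  exact ⟨Y, hXY, hY.subPerm⟩

theorem SubPerm.transpose {Y : Matrix (Fin n) (Fin n) F} (hY : SubPerm Y) : SubPerm Yᵀ :=
  ⟨fun i j k => hY.2 j k i, fun i j k => hY.1 k i j⟩

theorem SubPerm.mul_apply_of_ne_zero {Y R : Matrix (Fin n) (Fin n) F} (hY : SubPerm Y)
    {i j : Fin n} (hij : Y i j ≠ 0) (b : Fin n) : (Y * R) i b = Y i j * R j b := by
  rw [mul_apply]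
  refine Finset.sum_eq_single j (fun c _ hc => ?_) (by simp)
  rw [by_contra fun h => hc (hY.1 i c j h hij), zero_mul]

/-- A nonzero entry of `Y * R` lies weakly to the right of a nonzero entry of `Y`. -/
theorem exists_le_of_mul_apply_ne_zero {Y R : Matrix (Fin n) (Fin n) F} (hR : InU R)
    {i b : Fin n} (hib : (Y * R) i b ≠ 0) : ∃ j ≤ b, Y i j ≠ 0 := by
  rw [mul_apply] at hib
  obtain ⟨j, -, hj⟩ := Finset.exists_ne_zero_of_sum_ne_zero hib
  exact ⟨j, le_of_not_gt fun h => right_ne_zero_of_mul hj (hR.2 j b h), left_ne_zero_of_mul hj⟩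

theorem SubPerm.apply_eq_of_ne_zero {Y Z h k : Matrix (Fin n) (Fin n) F} (hY : SubPerm Y)
    (hZ : SubPerm Z) (hh : InU h) (hk : InU k) (hYZ : hᵀ * Z = Y * k) (i : Fin n) :
    ∀ j, Z i j ≠ 0 → Y i j = Z i j := by
  have htr : ∀ a b, (Y * k) a b = (Zᵀ * h) b a := fun a b => by
    rw [← hYZ, ← transpose_apply (hᵀ * Z), transpose_mul, transpose_transpose]
  induction i using WellFoundedLT.induction with
  | ind i ih =>
    intro j hij
    have hZij : (Y * k) i j = Z i j := by
      rw [htr, hZ.transpose.mul_apply_of_ne_zero (i := j) (j := i) hij, hh.1, mul_one,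
        transpose_apply]
    obtain ⟨c, -, hc⟩ := exists_le_of_mul_apply_ne_zero hk (hZij ▸ hij)
    have hYic : (Y * k) i c = Y i c := by
      rw [hY.mul_apply_of_ne_zero hc, hk.1, mul_one]
    obtain ⟨a, hai, ha⟩ := exists_le_of_mul_apply_ne_zero hh (htr i c ▸ hYic ▸ hc)
    rw [transpose_apply] at ha
    obtain rfl : a = i := by
      by_contra hne
      exact hne (hY.2 a i c (by rwa [ih a (lt_of_le_of_ne hai hne) c ha]) hc)
    obtain rfl := hZ.1 a c j ha hij
    rw [← hYic, hZij]

theorem SubPerm.eq_of_uEquiv {Y Z : Matrix (Fin n) (Fin n) F} (hY : SubPerm Y) (hZ : SubPerm Z)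
    (hYZ : UEquiv Y Z) : Y = Z := by
  obtain ⟨h, k, hh, hk, rfl⟩ := hYZ.symm
  have hki : hᵀ * Z = hᵀ * Z * k * k⁻¹ := by
    rw [Matrix.mul_assoc _ k, mul_nonsing_inv k hk.isUnit_det, Matrix.mul_one]
  have hYZ' := hY.apply_eq_of_ne_zero hZ hh hk.inv hki
  have hZY := hZ.transpose.apply_eq_of_ne_zero hY.transpose hk.inv hh
    (by simpa only [transpose_mul, transpose_transpose] using (congrArg Matrix.transpose hki).symm)
  ext i j
  by_cases hij : Z i j = 0
  · by_contra hne
    exact hne (hZY j i (by rwa [transpose_apply, ← hij])).symm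
  · exact hYZ' i j hij

/-- Every matrix is `U`-equivalent to a unique sub-permutation matrix. -/
theorem unique_subperm_U_equivalent (hn : 2 ≤ n)
    (X : Matrix (Fin n) (Fin n) F) :
    ∃! Y : Matrix (Fin n) (Fin n) F, SubPerm Y ∧
      ∃ h k : Matrix (Fin n) (Fin n) F, InU h ∧ InU k ∧ Y = hᵀ * X * k := by
  obtain ⟨Y, hXY, hY⟩ := exists_uEquiv_subPerm X
  refine ⟨Y, ⟨hY, hXY⟩, fun Z ⟨hZ, hXZ⟩ => ?_⟩
  exact hZ.eq_of_uEquiv hY ((UEquiv.symm hXZ).trans hXY)
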